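/- Assume additionally ε ≤ d−1. For any λ > 0 and any positive integer N with N ≥ 2(e^ε+3)²(1+λ)²/(0.24²·λ²)·ln(8(1+λ)/(0.24·λ)), for every deterministic one-hot input x: E[‖x̂^mrc − x‖²] ≤ (1 + 4λ + 5λ² + 2λ³)·E[‖x̂^ss − x‖²], where the left expectation is over the i.i.d. uniform candidates and the selected index K of MRC simulating Subset Selection, and the right expectation is over z ~ q^ss(·|x). -/

import Mathlib

open scoped Classical
open Real Finset

noncomputable section

/-- The output alphabet of Subset Selection: subsets of `[d]` of size `s`. -/
def zset (d s : ℕ) : Finset (Finset (Fin d)) := Finset.powersetCard s Finset.univ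

/-- Normalizing constant of the Subset Selection pmf. -/
def qssC (d s : ℕ) (ε : ℝ) : ℝ :=
  ((d - 1).choose (s - 1) : ℝ) * Real.exp ε + ((d - 1).choose s : ℝ)

/-- The Subset Selection pmf `q^ss(A | e_j)`. -/
def qss (d s : ℕ) (ε : ℝ) (j : Fin d) (A : Finset (Fin d)) : ℝ :=
  if j ∈ A then Real.exp ε / qssC d s ε else 1 / qssC d s ε

/-- Subset Selection scaling factor `m_ss`. -/
def mss (d s : ℕ) (ε : ℝ) : ℝ :=
  (s : ℝ) * ((d : ℝ) - (s : ℝ)) * (Real.exp ε - 1) /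
    (((d : ℝ) - 1) * ((s : ℝ) * (Real.exp ε - 1) + (d : ℝ)))

/-- Subset Selection offset `b_ss`. -/
def bss (d s : ℕ) (ε : ℝ) : ℝ :=
  (s : ℝ) * (((s : ℝ) - 1) * Real.exp ε + ((d : ℝ) - (s : ℝ))) /
    (((d : ℝ) - 1) * ((s : ℝ) * (Real.exp ε - 1) + (d : ℝ)))

/-- The Subset Selection estimator `x̂^ss = (z − b_ss·𝟙)/m_ss`, coordinate `i`. -/
def xhatSS (d s : ℕ) (ε : ℝ) (A : Finset (Fin d)) (i : Fin d) : ℝ :=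
  ((if i ∈ A then (1 : ℝ) else 0) - bss d s ε) / mss d s ε

/-- Expectation of `f(M/N)` for `M ~ Binomial(N, μ)`. -/
def binomExp (N : ℕ) (μ : ℝ) (f : ℝ → ℝ) : ℝ :=
  ∑ M ∈ Finset.range (N + 1),
    (N.choose M : ℝ) * μ ^ M * (1 - μ) ^ (N - M) * f ((M : ℝ) / (N : ℝ))

/-- The in-cap selection probability of MRC given in-cap fraction `θ`. -/
def hMrc (ε θ : ℝ) : ℝ := Real.exp ε * θ / (Real.exp ε * θ + (1 - θ))

/-- MRC-simulating-Subset-Selection offset `b_mrc`. -/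
def bMrcSS (d s N : ℕ) (ε : ℝ) : ℝ :=
  (1 / ((d : ℝ) - 1)) * binomExp N ((s : ℝ) / (d : ℝ)) (fun θ => (s : ℝ) - hMrc ε θ)

/-- MRC-simulating-Subset-Selection scaling factor `m_mrc`. -/
def mMrcSS (d s N : ℕ) (ε : ℝ) : ℝ :=
  binomExp N ((s : ℝ) / (d : ℝ)) (hMrc ε) - bMrcSS d s N ε

/-- The MRC index distribution simulating Subset Selection:
`P(K = k) ∝ e^ε` for in-cap candidates and `∝ 1` for out-cap candidates. -/
def piMrcSS (d N : ℕ) (ε : ℝ) (j : Fin d) (zs : Fin N → Finset (Fin d)) (k : Fin N) : ℝ :=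
  (if j ∈ zs k then Real.exp ε else 1) /
    ∑ k' : Fin N, (if j ∈ zs k' then Real.exp ε else 1)

/-- Marginal output distribution of MRC simulating Subset Selection over
i.i.d. uniform candidates and the selected index. -/
def qMrcOut (d s N : ℕ) (ε : ℝ) (j : Fin d) (A : Finset (Fin d)) : ℝ :=
  ∑ zs ∈ Fintype.piFinset (fun _ : Fin N => zset d s),
    (1 / ((zset d s).card : ℝ)) ^ N *
      ∑ k : Fin N, if zs k = A then piMrcSS d N ε j zs k else 0

/-- The debiased MRC estimator `x̂^mrc = (Z_K − b_mrc·𝟙)/m_mrc`, coordinate `i`. -/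
def xhatMrc (d s N : ℕ) (ε : ℝ) (A : Finset (Fin d)) (i : Fin d) : ℝ :=
  ((if i ∈ A then (1 : ℝ) else 0) - bMrcSS d s N ε) / mMrcSS d s N ε

/-- The MMRC index distribution simulating Subset Selection (with `μ = s/d` and
`a = e^ε·μ + (1−μ)`). -/
def piMmrcSS (d s N : ℕ) (ε : ℝ) (j : Fin d) (zs : Fin N → Finset (Fin d)) (k : Fin N) : ℝ :=
  let θ : ℝ := ((Finset.univ.filter fun i : Fin N => j ∈ zs i).card : ℝ) / (N : ℝ)
  let μ : ℝ := (s : ℝ) / (d : ℝ)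
  let a : ℝ := Real.exp ε * μ + (1 - μ)
  if θ < μ then
    (if j ∈ zs k then Real.exp ε / ((N : ℝ) * a)
     else (1 - θ * Real.exp ε / a) / ((N : ℝ) * (1 - θ)))
  else if μ < θ then
    (if j ∈ zs k then (1 - (1 - θ) / a) / ((N : ℝ) * θ) else 1 / ((N : ℝ) * a))
  else
    (if j ∈ zs k then Real.exp ε / ((N : ℝ) * (Real.exp ε * θ + (1 - θ)))
     else 1 / ((N : ℝ) * (Real.exp ε * θ + (1 - θ))))

/-- `g(θ) = (e^ε θ/a)·1{θ≤μ} + ((e^ε μ + θ − μ)/a)·1{θ>μ}`. -/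
def gMmrc (ε μ θ : ℝ) : ℝ :=
  if θ ≤ μ then Real.exp ε * θ / (Real.exp ε * μ + (1 - μ))
  else (Real.exp ε * μ + θ - μ) / (Real.exp ε * μ + (1 - μ))

/-- `E[g(θ)]` over `N·θ ~ Binomial(N, s/d)`. -/
def egMmrc (d s N : ℕ) (ε : ℝ) : ℝ :=
  binomExp N ((s : ℝ) / (d : ℝ)) (gMmrc ε ((s : ℝ) / (d : ℝ)))

/-- MMRC-simulating-Subset-Selection scaling factor `m_mmrc`. -/
def mMmrcSS (d s N : ℕ) (ε : ℝ) : ℝ :=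
  ((d : ℝ) / ((d : ℝ) - 1)) * egMmrc d s N ε - (s : ℝ) / ((d : ℝ) - 1)

/-- MMRC-simulating-Subset-Selection offset `b_mmrc`. -/
def bMmrcSS (d s N : ℕ) (ε : ℝ) : ℝ :=
  (1 / ((d : ℝ) - 1)) * ((s : ℝ) - egMmrc d s N ε)

/-- Marginal output distribution of MMRC simulating Subset Selection over
i.i.d. uniform candidates and the selected index. -/
def qMmrcOut (d s N : ℕ) (ε : ℝ) (j : Fin d) (A : Finset (Fin d)) : ℝ :=
  ∑ zs ∈ Fintype.piFinset (fun _ : Fin N => zset d s),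
    (1 / ((zset d s).card : ℝ)) ^ N *
      ∑ k : Fin N, if zs k = A then piMmrcSS d s N ε j zs k else 0

/-- The debiased MMRC estimator `x̂^mmrc = (Z_K − b_mmrc·𝟙)/m_mmrc`, coordinate `i`. -/
def xhatMmrc (d s N : ℕ) (ε : ℝ) (A : Finset (Fin d)) (i : Fin d) : ℝ :=
  ((if i ∈ A then (1 : ℝ) else 0) - bMmrcSS d s N ε) / mMmrcSS d s N ε

/-- Per-user expected squared error of Subset Selection on one-hot input `e_j`. -/
def errSSone (d s : ℕ) (ε : ℝ) (j : Fin d) : ℝ :=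
  ∑ A ∈ zset d s, qss d s ε j A *
    ∑ i : Fin d, (xhatSS d s ε A i - (if i = j then (1 : ℝ) else 0)) ^ 2

/-- Per-user expected squared error of MRC simulating Subset Selection on input `e_j`. -/
def errMrcOne (d s N : ℕ) (ε : ℝ) (j : Fin d) : ℝ :=
  ∑ A ∈ zset d s, qMrcOut d s N ε j A *
    ∑ i : Fin d, (xhatMrc d s N ε A i - (if i = j then (1 : ℝ) else 0)) ^ 2

/-- Per-user expected squared error of MMRC simulating Subset Selection on input `e_j`. -/
def errMmrcOne (d s N : ℕ) (ε : ℝ) (j : Fin d) : ℝ :=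
  ∑ A ∈ zset d s, qMmrcOut d s N ε j A *
    ∑ i : Fin d, (xhatMmrc d s N ε A i - (if i = j then (1 : ℝ) else 0)) ^ 2

/-- `n`-user frequency-estimation squared error of Subset Selection on inputs
`e_{xs 1}, …, e_{xs n}`. -/
def errSSMech (d s n : ℕ) (ε : ℝ) (xs : Fin n → Fin d) : ℝ :=
  ∑ zt ∈ Fintype.piFinset (fun _ : Fin n => zset d s),
    (∏ i : Fin n, qss d s ε (xs i) (zt i)) *
      ∑ j : Fin d,
        ((1 / (n : ℝ)) * (∑ i : Fin n, xhatSS d s ε (zt i) j) -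
            (1 / (n : ℝ)) * (∑ i : Fin n, if j = xs i then (1 : ℝ) else 0)) ^ 2

/-- `n`-user frequency-estimation squared error of MMRC simulating Subset Selection. -/
def errMmrcMech (d s N n : ℕ) (ε : ℝ) (xs : Fin n → Fin d) : ℝ :=
  ∑ zt ∈ Fintype.piFinset (fun _ : Fin n => zset d s),
    (∏ i : Fin n, qMmrcOut d s N ε (xs i) (zt i)) *
      ∑ j : Fin d,
        ((1 / (n : ℝ)) * (∑ i : Fin n, xhatMmrc d s N ε (zt i) j) -
            (1 / (n : ℝ)) * (∑ i : Fin n, if j = xs i then (1 : ℝ) else 0)) ^ 2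
theorem card_zset (d s : ℕ) : (zset d s).card = d.choose s := by
  simp [zset]

theorem card_zset_filter_notMem {d : ℕ} (s : ℕ) (j : Fin d) :
    ((zset d s).filter fun A => j ∉ A).card = (d - 1).choose s := by
  have h : (zset d s).filter (fun A => j ∉ A) = powersetCard s (univ.erase j) := by
    ext A
    simp only [zset, mem_filter, mem_powersetCard, subset_univ, true_and, subset_erase]
    tauto
  rw [h, card_powersetCard, card_erase_of_mem (mem_univ j), card_univ, Fintype.card_fin]

theorem card_zset_filter_mem {d s : ℕ} (hs : 1 ≤ s) (j : Fin d) :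
    ((zset d s).filter fun A => j ∈ A).card = (d - 1).choose (s - 1) := by
  have h := card_filter_add_card_filter_not (s := zset d s) (fun A => j ∈ A)
  rw [card_zset_filter_notMem, card_zset] at h
  obtain ⟨s, rfl⟩ := Nat.exists_eq_add_of_le' hs
  obtain ⟨d, rfl⟩ := Nat.exists_eq_add_of_le' j.pos
  rw [Nat.choose_succ_succ'] at h
  simp only [Nat.add_sub_cancel] at h ⊢
  omega

/-- The squared error of a debiased subset estimator depends on the output distribution `w` only
through the probability `p` that the selected subset contains `j`. -/
theorem sum_mul_sq_error {d s : ℕ} (hd : 2 ≤ d) (j : Fin d) (w : Finset (Fin d) → ℝ) (p b m : ℝ)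
    (hw : ∑ A ∈ zset d s, w A = 1)
    (hp : ∑ A ∈ zset d s, (if j ∈ A then w A else 0) = p)
    (hb : b = ((s : ℝ) - p) / ((d : ℝ) - 1)) (hm : m = p - b) (hm0 : m ≠ 0) :
    ∑ A ∈ zset d s, w A *
        ∑ i : Fin d, (((if i ∈ A then (1 : ℝ) else 0) - b) / m - (if i = j then (1 : ℝ) else 0)) ^ 2
      = (s : ℝ) * ((d : ℝ) - s) / d / m ^ 2 - ((d : ℝ) - 1) / d := by
  have hd' : (2 : ℝ) ≤ d := by exact_mod_cast hd
  have hd1 : (d : ℝ) - 1 ≠ 0 := by linarith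
  have hd0 : (d : ℝ) ≠ 0 := by linarith
  have key : ∀ A ∈ zset d s,
      w A * ∑ i : Fin d,
          (((if i ∈ A then (1 : ℝ) else 0) - b) / m - (if i = j then (1 : ℝ) else 0)) ^ 2
        = w A * ((s * (1 - 2 * b) + d * b ^ 2) / m ^ 2 + 1 + 2 * b / m)
          - (if j ∈ A then w A else 0) * (2 / m) := by
    intro A hA
    have hcard : A.card = s := (mem_powersetCard.1 hA).2
    have hsplit : ∀ i : Fin d,
        (((if i ∈ A then (1 : ℝ) else 0) - b) / m - (if i = j then (1 : ℝ) else 0)) ^ 2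
          = (if i ∈ A then (1 : ℝ) else 0) * ((1 - 2 * b) / m ^ 2) + b ^ 2 / m ^ 2
            + (if i = j then 1 + 2 * b / m - 2 / m * (if j ∈ A then (1 : ℝ) else 0) else 0) := by
      intro i
      by_cases hij : i = j
      · subst hij
        by_cases hi : i ∈ A <;> simp only [hi, if_true, if_false] <;> field_simp <;> ring
      · by_cases hi : i ∈ A <;> simp only [hi, hij, if_true, if_false] <;> field_simp <;> ring
    simp_rw [hsplit]
    rw [sum_add_distrib, sum_add_distrib, ← sum_mul, sum_ite_eq' univ j]
    have hone : ∑ i : Fin d, (if i ∈ A then (1 : ℝ) else 0) = s := by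
      simp [hcard]
    rw [hone]
    simp only [mem_univ, if_true, sum_const, card_univ, Fintype.card_fin, nsmul_eq_mul]
    split_ifs <;> field_simp <;> ring
  rw [sum_congr rfl key, sum_sub_distrib, ← sum_mul, ← sum_mul, hw, hp]
  have hp' : p = ((d - 1) * m + s) / d := by
    rw [hm, hb]; field_simp; ring
  have hb' : b = (s - m) / d := by
    rw [hb, hp']; field_simp; ring
  rw [hp', hb']
  field_simp
  ring

/-- The number of indices satisfying `P` in a uniform sample from `Z ^ N` is binomial. -/
theorem sum_piFinset_card_filter {α : Type*} (Z : Finset α) (P : α → Prop) [DecidablePred P]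
    (N : ℕ) (F : ℕ → ℝ) :
    ∑ zs ∈ Fintype.piFinset (fun _ : Fin N => Z), F ((univ.filter fun k => P (zs k)).card)
      = ∑ M ∈ range (N + 1), (N.choose M : ℝ) * ((Z.filter P).card : ℝ) ^ M *
          ((Z.filter fun a => ¬ P a).card : ℝ) ^ (N - M) * F M := by
  have hmaps : ∀ zs ∈ Fintype.piFinset (fun _ : Fin N => Z),
      (univ.filter fun k => P (zs k)) ∈ (univ : Finset (Fin N)).powerset := fun _ _ => by simp
  rw [← sum_fiberwise_of_maps_to hmaps]
  have hfib : ∀ S ∈ (univ : Finset (Fin N)).powerset,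
      ∑ zs ∈ Fintype.piFinset (fun _ : Fin N => Z) with (univ.filter fun k => P (zs k)) = S,
        F ((univ.filter fun k => P (zs k)).card)
      = ((Z.filter P).card : ℝ) ^ S.card *
          ((Z.filter fun a => ¬ P a).card : ℝ) ^ (N - S.card) * F S.card := by
    intro S _
    have hset : (Fintype.piFinset (fun _ : Fin N => Z)).filter
          (fun zs => (univ.filter fun k => P (zs k)) = S)
        = Fintype.piFinset (fun k : Fin N => if k ∈ S then Z.filter P
            else Z.filter fun a => ¬ P a) := by
      ext zs
      simp only [mem_filter, Fintype.mem_piFinset, Finset.ext_iff, mem_univ, true_and]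
      constructor
      · rintro ⟨h1, h2⟩ k
        by_cases hk : k ∈ S
        · simp [hk, h1 k, (h2 k).2 hk]
        · simp [hk, h1 k, (h2 k).not.2 hk]
      · intro h
        refine ⟨fun k => ?_, fun k => ?_⟩ <;>
          · have := h k
            by_cases hk : k ∈ S <;> simp_all
    rw [sum_congr rfl (g := fun _ => F S.card) (fun zs hzs => by rw [(mem_filter.1 hzs).2]),
      sum_const, hset, Fintype.card_piFinset, nsmul_eq_mul]
    congr 1
    push_cast
    have hite : ∀ k : Fin N, ((if k ∈ S then Z.filter P else Z.filter fun a => ¬ P a).card : ℝ)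
        = if k ∈ S then ((Z.filter P).card : ℝ) else ((Z.filter fun a => ¬ P a).card : ℝ) :=
      fun k => by split_ifs <;> rfl
    simp_rw [hite]
    rw [prod_ite, prod_const, prod_const]
    congr 2
    · simp
    · rw [filter_not, card_sdiff_of_subset (filter_subset _ _)]
      simp
  rw [sum_congr rfl hfib, sum_powerset_apply_card
    (fun M => ((Z.filter P).card : ℝ) ^ M * ((Z.filter fun a => ¬ P a).card : ℝ) ^ (N - M) * F M)]
  simp only [card_univ, Fintype.card_fin, nsmul_eq_mul, mul_assoc]

theorem cast_mul_choose_sub_one {d s : ℕ} (hd : 1 ≤ d) (hs : 1 ≤ s) :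
    (d : ℝ) * ((d - 1).choose (s - 1) : ℝ) = (d.choose s : ℝ) * s := by
  obtain ⟨s, rfl⟩ := Nat.exists_eq_add_of_le' hs
  obtain ⟨d, rfl⟩ := Nat.exists_eq_add_of_le' hd
  exact_mod_cast Nat.add_one_mul_choose_eq d s

theorem cast_mul_choose_pred {d s : ℕ} (hs : 1 ≤ s) (hsd : s ≤ d) :
    (d : ℝ) * ((d - 1).choose s : ℝ) = (d.choose s : ℝ) * (d - s) := by
  have h1 := cast_mul_choose_sub_one (hs.trans hsd) hs
  have h2 : (d.choose s : ℝ) = (d - 1).choose (s - 1) + (d - 1).choose s := by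
    obtain ⟨s, rfl⟩ := Nat.exists_eq_add_of_le' hs
    obtain ⟨d, rfl⟩ := Nat.exists_eq_add_of_le' (hs.trans hsd)
    exact_mod_cast Nat.choose_succ_succ d s
  have h3 : ((d - 1).choose s : ℝ) = d.choose s - (d - 1).choose (s - 1) := by linarith
  rw [h3, mul_sub, h1]
  ring

/-- A sample average over uniform candidates of a function of the in-cap fraction is the
corresponding binomial expectation. -/
theorem sum_candidates_eq_binomExp {d s N : ℕ} (hs : 1 ≤ s) (hsd : s ≤ d) (j : Fin d)
    (f : ℝ → ℝ) :
    ∑ zs ∈ Fintype.piFinset (fun _ : Fin N => zset d s), (1 / ((zset d s).card : ℝ)) ^ N *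
        f (((univ.filter fun k => j ∈ zs k).card : ℝ) / N)
      = binomExp N ((s : ℝ) / d) f := by
  have hd : 1 ≤ d := hs.trans hsd
  have hd0 : (d : ℝ) ≠ 0 := by positivity
  have hc0 : (d.choose s : ℝ) ≠ 0 := by
    have := Nat.choose_pos hsd
    positivity
  have hin : ((d - 1).choose (s - 1) : ℝ) = d.choose s * ((s : ℝ) / d) := by
    have := cast_mul_choose_sub_one hd hs
    field_simp
    linarith
  have hout : ((d - 1).choose s : ℝ) = d.choose s * (1 - (s : ℝ) / d) := by
    have := cast_mul_choose_pred hs hsd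
    field_simp
    linarith
  rw [← mul_sum, sum_piFinset_card_filter (zset d s) (fun A => j ∈ A) N (fun M => f ((M : ℝ) / N)),
    card_zset_filter_mem hs, card_zset_filter_notMem, card_zset, hin, hout, mul_sum, binomExp]
  refine sum_congr rfl fun M hM => ?_
  have hMN : M + (N - M) = N := by
    have := mem_range.1 hM
    omega
  have hpow : (d.choose s : ℝ) ^ N = (d.choose s : ℝ) ^ M * (d.choose s : ℝ) ^ (N - M) := by
    rw [← pow_add, hMN]
  rw [one_div, inv_pow, hpow, mul_pow, mul_pow]
  field_simp

theorem sum_ite_exp {d N : ℕ} (ε : ℝ) (j : Fin d) (zs : Fin N → Finset (Fin d)) :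
    ∑ k : Fin N, (if j ∈ zs k then Real.exp ε else 1)
      = Real.exp ε * ((univ.filter fun k => j ∈ zs k).card : ℝ)
        + (N - ((univ.filter fun k => j ∈ zs k).card : ℝ)) := by
  have h : ∀ k, (if j ∈ zs k then Real.exp ε else 1)
      = 1 + (Real.exp ε - 1) * (if j ∈ zs k then (1 : ℝ) else 0) :=
    fun k => by split_ifs <;> ring
  simp_rw [h]
  rw [sum_add_distrib, ← mul_sum, sum_boole]
  simp
  ring

theorem sum_ite_exp_pos {d N : ℕ} (hN : 0 < N) (ε : ℝ) (j : Fin d) (zs : Fin N → Finset (Fin d)) :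
    0 < ∑ k : Fin N, (if j ∈ zs k then Real.exp ε else 1) := by
  have : Nonempty (Fin N) := ⟨⟨0, hN⟩⟩
  refine sum_pos (fun k _ => ?_) univ_nonempty
  split_ifs <;> positivity

theorem sum_piMrcSS {d N : ℕ} (hN : 0 < N) (ε : ℝ) (j : Fin d) (zs : Fin N → Finset (Fin d)) :
    ∑ k : Fin N, piMrcSS d N ε j zs k = 1 := by
  simp only [piMrcSS]
  rw [← sum_div, div_self (sum_ite_exp_pos hN ε j zs).ne']

theorem sum_piMrcSS_mem {d N : ℕ} (hN : 0 < N) (ε : ℝ) (j : Fin d) (zs : Fin N → Finset (Fin d)) :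
    ∑ k : Fin N, (if j ∈ zs k then piMrcSS d N ε j zs k else 0)
      = hMrc ε (((univ.filter fun k => j ∈ zs k).card : ℝ) / N) := by
  have hpos := sum_ite_exp_pos hN ε j zs
  have h : ∀ k, (if j ∈ zs k then piMrcSS d N ε j zs k else 0)
      = (if j ∈ zs k then (1 : ℝ) else 0) *
        (Real.exp ε / ∑ k' : Fin N, (if j ∈ zs k' then Real.exp ε else 1)) := by
    intro k
    by_cases hk : j ∈ zs k <;> simp [piMrcSS, hk]
  simp_rw [h]
  rw [← sum_mul, sum_boole]
  rw [sum_ite_exp] at hpos ⊢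
  have hN' : (N : ℝ) ≠ 0 := by positivity
  rw [hMrc]
  generalize ((univ.filter fun k => j ∈ zs k).card : ℝ) = c at hpos ⊢
  have h2 : Real.exp ε * (c / N) + (1 - c / N) = (Real.exp ε * c + (N - c)) / N := by
    field_simp
  rw [h2]
  have := hpos.ne'
  field_simp

theorem sum_qMrcOut_mul {d s N : ℕ} (ε : ℝ) (j : Fin d) (g : Finset (Fin d) → ℝ) :
    ∑ A ∈ zset d s, qMrcOut d s N ε j A * g A
      = ∑ zs ∈ Fintype.piFinset (fun _ : Fin N => zset d s), (1 / ((zset d s).card : ℝ)) ^ N *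
          ∑ k : Fin N, piMrcSS d N ε j zs k * g (zs k) := by
  simp only [qMrcOut, sum_mul]
  rw [sum_comm]
  refine sum_congr rfl fun zs hzs => ?_
  simp only [mul_assoc]
  rw [← mul_sum]
  congr 1
  simp only [sum_mul]
  rw [sum_comm]
  refine sum_congr rfl fun k _ => ?_
  simp only [ite_mul, zero_mul]
  rw [sum_ite_eq, if_pos (Fintype.mem_piFinset.1 hzs k)]

theorem sum_qMrcOut {d s N : ℕ} (hN : 0 < N) (hsd : s ≤ d) (ε : ℝ) (j : Fin d) :
    ∑ A ∈ zset d s, qMrcOut d s N ε j A = 1 := by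
  have h := sum_qMrcOut_mul (s := s) (N := N) ε j (fun _ => 1)
  simp only [mul_one, sum_piMrcSS hN] at h
  rw [h, sum_const, Fintype.card_piFinset_const, nsmul_eq_mul, Nat.cast_pow, ← mul_pow, card_zset]
  have := Nat.choose_pos hsd
  rw [mul_one_div_cancel (by positivity), one_pow]

theorem sum_qMrcOut_mem {d s N : ℕ} (hN : 0 < N) (hs : 1 ≤ s) (hsd : s ≤ d) (ε : ℝ) (j : Fin d) :
    ∑ A ∈ zset d s, (if j ∈ A then qMrcOut d s N ε j A else 0)
      = binomExp N ((s : ℝ) / d) (hMrc ε) := by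
  have h := sum_qMrcOut_mul (s := s) (N := N) ε j (fun A => if j ∈ A then 1 else 0)
  simp only [mul_ite, mul_one, mul_zero, sum_piMrcSS_mem hN] at h
  rw [h, sum_candidates_eq_binomExp hs hsd]

theorem binomExp_eq_sum_bernstein (N : ℕ) (μ : ℝ) (f : ℝ → ℝ) :
    binomExp N μ f
      = ∑ M ∈ range (N + 1), (bernsteinPolynomial ℝ N M).eval μ * f ((M : ℝ) / N) := by
  simp [binomExp, bernsteinPolynomial]

theorem binomExp_const (N : ℕ) (μ c : ℝ) : binomExp N μ (fun _ => c) = c := by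
  have h := congrArg (Polynomial.eval μ) (bernsteinPolynomial.sum ℝ N)
  rw [Polynomial.eval_finsetSum, Polynomial.eval_one] at h
  rw [binomExp_eq_sum_bernstein, ← sum_mul, h, one_mul]

theorem binomExp_add (N : ℕ) (μ : ℝ) (f g : ℝ → ℝ) :
    binomExp N μ (fun θ => f θ + g θ) = binomExp N μ f + binomExp N μ g := by
  simp only [binomExp, mul_add, sum_add_distrib]

theorem binomExp_const_mul (N : ℕ) (μ c : ℝ) (f : ℝ → ℝ) :
    binomExp N μ (fun θ => c * f θ) = c * binomExp N μ f := by
  simp only [binomExp, mul_sum]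
  exact sum_congr rfl fun M _ => by ring

theorem binomExp_sub_mean {N : ℕ} (hN : 0 < N) (μ : ℝ) : binomExp N μ (fun θ => θ - μ) = 0 := by
  have h := congrArg (Polynomial.eval μ) (bernsteinPolynomial.sum_smul ℝ N)
  simp only [Polynomial.eval_finsetSum, nsmul_eq_mul] at h
  have hN' : (N : ℝ) ≠ 0 := by positivity
  have h1 : binomExp N μ (fun θ => θ) = μ := by
    rw [binomExp_eq_sum_bernstein]
    have h2 : (N : ℝ) * ∑ M ∈ range (N + 1), (bernsteinPolynomial ℝ N M).eval μ * ((M : ℝ) / N)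
        = N * μ := by
      rw [mul_sum]
      refine Eq.trans (sum_congr rfl fun M _ => ?_) (by simpa using h)
      field_simp
    exact mul_left_cancel₀ hN' h2
  have h3 := binomExp_add N μ (fun θ => θ) (fun _ => -μ)
  rw [h1, binomExp_const] at h3
  simpa [sub_eq_add_neg] using h3

theorem binomExp_variance {N : ℕ} (hN : 0 < N) (μ : ℝ) :
    binomExp N μ (fun θ => (θ - μ) ^ 2) = μ * (1 - μ) / N := by
  have h := congrArg (Polynomial.eval μ) (bernsteinPolynomial.variance ℝ N)
  have hN' : (N : ℝ) ≠ 0 := by positivity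
  have h2 : (N : ℝ) ^ 2 * binomExp N μ (fun θ => (θ - μ) ^ 2) = N * (μ * (1 - μ)) := by
    rw [binomExp_eq_sum_bernstein, mul_sum]
    simp [Polynomial.eval_finsetSum] at h
    rw [← mul_assoc, ← h]
    refine sum_congr rfl fun M _ => ?_
    field_simp
    ring
  field_simp
  have h3 : (N : ℝ) * (N * binomExp N μ (fun θ => (θ - μ) ^ 2)) = N * (μ * (1 - μ)) := by
    rw [← h2]; ring
  have h4 := mul_left_cancel₀ hN' h3
  linarith

theorem binomExp_mono {N : ℕ} {μ : ℝ} (h0 : 0 ≤ μ) (h1 : μ ≤ 1) {f g : ℝ → ℝ}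
    (hfg : ∀ θ, 0 ≤ θ → f θ ≤ g θ) : binomExp N μ f ≤ binomExp N μ g := by
  refine sum_le_sum fun M _ => ?_
  have : 0 ≤ 1 - μ := by linarith
  exact mul_le_mul_of_nonneg_left (hfg _ (by positivity)) (by positivity)

/-- Quadratic lower bound for the concave function `hMrc ε` around `μ`. -/
theorem hMrc_ge_quadratic {ε μ θ : ℝ} (hε : 0 ≤ ε) (hμ : 0 ≤ μ) (hθ : 0 ≤ θ) :
    hMrc ε μ + (Real.exp ε / (Real.exp ε * μ + (1 - μ)) ^ 2 * (θ - μ)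
        + -(Real.exp ε * (Real.exp ε - 1) / (Real.exp ε * μ + (1 - μ)) ^ 2) * (θ - μ) ^ 2)
      ≤ hMrc ε θ := by
  have hE : 1 ≤ Real.exp ε := Real.one_le_exp hε
  rw [hMrc, hMrc]
  generalize Real.exp ε = E at hE ⊢
  have ha : 0 < E * μ + (1 - μ) := by nlinarith
  have hA : 1 ≤ E * θ + (1 - θ) := by nlinarith
  have hA0 : 0 < E * θ + (1 - θ) := by linarith
  have key : E * θ / (E * θ + (1 - θ)) - (E * μ / (E * μ + (1 - μ))
      + (E / (E * μ + (1 - μ)) ^ 2 * (θ - μ)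
        + -(E * (E - 1) / (E * μ + (1 - μ)) ^ 2) * (θ - μ) ^ 2))
      = E * (E - 1) ^ 2 * θ * (θ - μ) ^ 2
          / ((E * μ + (1 - μ)) ^ 2 * (E * θ + (1 - θ))) := by
    field_simp
    ring
  have : 0 ≤ E * (E - 1) ^ 2 * θ * (θ - μ) ^ 2
          / ((E * μ + (1 - μ)) ^ 2 * (E * θ + (1 - θ))) := by positivity
  linarith

/-- Second-order lower bound on the MRC in-cap probability. -/
theorem binomExp_hMrc_ge {N : ℕ} (hN : 0 < N) {ε μ : ℝ} (hε : 0 ≤ ε) (h0 : 0 ≤ μ) (h1 : μ ≤ 1) :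
    μ + (hMrc ε μ - μ) * (1 - Real.exp ε / N) ≤ binomExp N μ (hMrc ε) := by
  have h := binomExp_mono (N := N) h0 h1
    (fun θ hθ => hMrc_ge_quadratic (ε := ε) (μ := μ) hε h0 hθ)
  rw [binomExp_add, binomExp_add, binomExp_const_mul, binomExp_const_mul, binomExp_const,
    binomExp_sub_mean hN, binomExp_variance hN] at h
  refine le_trans ?_ h
  have hE : 1 ≤ Real.exp ε := Real.one_le_exp hε
  rw [hMrc]
  generalize Real.exp ε = E at hE ⊢
  have ha : 1 ≤ E * μ + (1 - μ) := by nlinarith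
  have ha0 : E * μ + (1 - μ) ≠ 0 := by linarith
  have hN' : (0 : ℝ) < N := by positivity
  have hdiff : E * μ / (E * μ + (1 - μ)) - μ = (E - 1) * μ * (1 - μ) / (E * μ + (1 - μ)) := by
    field_simp
    ring
  have key : E * μ / (E * μ + (1 - μ)) + (E / (E * μ + (1 - μ)) ^ 2 * 0
        + -(E * (E - 1) / (E * μ + (1 - μ)) ^ 2) * (μ * (1 - μ) / N))
      - (μ + (E - 1) * μ * (1 - μ) / (E * μ + (1 - μ)) * (1 - E / N))
      = E * (E - 1) ^ 2 * μ ^ 2 * (1 - μ) / ((E * μ + (1 - μ)) ^ 2 * N) := by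
    field_simp
    ring
  have h1' : 0 ≤ 1 - μ := by linarith
  have : 0 ≤ E * (E - 1) ^ 2 * μ ^ 2 * (1 - μ) / ((E * μ + (1 - μ)) ^ 2 * N) := by positivity
  rw [hdiff]
  linarith

theorem errMrcOne_eq {d s N : ℕ} (hd : 2 ≤ d) (hN : 0 < N) (hs : 1 ≤ s) (hsd : s ≤ d) (ε : ℝ)
    (j : Fin d) (hm : mMrcSS d s N ε ≠ 0) :
    errMrcOne d s N ε j
      = (s : ℝ) * ((d : ℝ) - s) / d / mMrcSS d s N ε ^ 2 - ((d : ℝ) - 1) / d := by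
  refine sum_mul_sq_error hd j _ (binomExp N ((s : ℝ) / d) (hMrc ε)) _ _
    (sum_qMrcOut hN hsd ε j) (sum_qMrcOut_mem hN hs hsd ε j) ?_ rfl hm
  have h := binomExp_add N ((s : ℝ) / d) (fun _ => (s : ℝ)) (fun θ => (-1) * hMrc ε θ)
  rw [binomExp_const, binomExp_const_mul] at h
  simp only [neg_mul, one_mul, ← sub_eq_add_neg] at h
  rw [bMrcSS, h]
  ring

theorem qssC_eq {d s : ℕ} (hs : 1 ≤ s) (hsd : s ≤ d) (ε : ℝ) :
    qssC d s ε = d.choose s * (s * Real.exp ε + (d - s)) / d := by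
  have hd0 : (d : ℝ) ≠ 0 := by
    have := hs.trans hsd
    positivity
  have h1 := cast_mul_choose_sub_one (hs.trans hsd) hs
  have h2 := cast_mul_choose_pred hs hsd
  rw [qssC, eq_div_iff hd0]
  linear_combination Real.exp ε * h1 + h2

theorem qssC_pos {d s : ℕ} (hs : 1 ≤ s) (hsd : s ≤ d) (ε : ℝ) : 0 < qssC d s ε := by
  have hd : 1 ≤ d := hs.trans hsd
  have := Nat.choose_pos hsd
  have h : (s : ℝ) ≤ d := by exact_mod_cast hsd
  have h' : (0 : ℝ) ≤ d - s := by linarith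
  rw [qssC_eq hs hsd]
  positivity

theorem sum_qss_mem {d s : ℕ} (hs : 1 ≤ s) (ε : ℝ) (j : Fin d) :
    ∑ A ∈ zset d s, (if j ∈ A then qss d s ε j A else 0)
      = (d - 1).choose (s - 1) * Real.exp ε / qssC d s ε := by
  have h : ∀ A ∈ zset d s, (if j ∈ A then qss d s ε j A else 0)
      = (if j ∈ A then (1 : ℝ) else 0) * (Real.exp ε / qssC d s ε) := by
    intro A _
    by_cases hA : j ∈ A <;> simp [qss, hA]
  rw [sum_congr rfl h, ← sum_mul, sum_boole, card_zset_filter_mem hs, mul_div_assoc]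

theorem sum_qss {d s : ℕ} (hs : 1 ≤ s) (hsd : s ≤ d) (ε : ℝ) (j : Fin d) :
    ∑ A ∈ zset d s, qss d s ε j A = 1 := by
  have h : ∀ A ∈ zset d s, qss d s ε j A
      = (if j ∈ A then (1 : ℝ) else 0) * (Real.exp ε / qssC d s ε)
        + (if j ∉ A then (1 : ℝ) else 0) * (1 / qssC d s ε) := by
    intro A _
    by_cases hA : j ∈ A <;> simp [qss, hA]
  rw [sum_congr rfl h, sum_add_distrib, ← sum_mul, ← sum_mul, sum_boole, sum_boole,
    card_zset_filter_mem hs, card_zset_filter_notMem]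
  have := (qssC_pos hs hsd ε).ne'
  rw [← mul_div_assoc, ← mul_div_assoc, mul_one, ← add_div]
  exact div_self this

theorem mss_eq {d s : ℕ} (hd : 2 ≤ d) (hsd : s ≤ d) (ε : ℝ) :
    mss d s ε = d / (d - 1) * (hMrc ε ((s : ℝ) / d) - (s : ℝ) / d) := by
  have hd' : (2 : ℝ) ≤ d := by exact_mod_cast hd
  have hd1 : (d : ℝ) - 1 ≠ 0 := by linarith
  have hd0 : (d : ℝ) ≠ 0 := by linarith
  have hsd' : (s : ℝ) ≤ d := by exact_mod_cast hsd
  have hpos : 0 < (s : ℝ) * Real.exp ε + (d - s) := by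
    rcases hsd'.eq_or_lt with h | h
    · rw [h, sub_self, add_zero]; positivity
    · have : (0 : ℝ) < d - s := by linarith
      positivity
  have h1 : (s : ℝ) * (Real.exp ε - 1) + d = s * Real.exp ε + (d - s) := by ring
  have h2 : Real.exp ε * ((s : ℝ) / d) + (1 - (s : ℝ) / d)
      = (s * Real.exp ε + (d - s)) / d := by
    field_simp
  have := hpos.ne'
  rw [mss, hMrc, h1, h2]
  field_simp
  ring

theorem errSSone_eq {d s : ℕ} (hd : 2 ≤ d) (hs : 1 ≤ s) (hsd : s ≤ d) (ε : ℝ)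
    (j : Fin d) (hm : mss d s ε ≠ 0) :
    errSSone d s ε j
      = (s : ℝ) * ((d : ℝ) - s) / d / mss d s ε ^ 2 - ((d : ℝ) - 1) / d := by
  have hd' : (2 : ℝ) ≤ d := by exact_mod_cast hd
  have hd1 : (d : ℝ) - 1 ≠ 0 := by linarith
  have hd0 : (d : ℝ) ≠ 0 := by linarith
  have hc0 : (d.choose s : ℝ) ≠ 0 := by
    have := Nat.choose_pos hsd
    positivity
  have hin : ((d - 1).choose (s - 1) : ℝ) = d.choose s * s / d := by
    rw [eq_div_iff hd0, ← cast_mul_choose_sub_one (hs.trans hsd) hs, mul_comm]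
  have hpos : 0 < (s : ℝ) * Real.exp ε + (d - s) := by
    have h1 : (s : ℝ) ≤ d := by exact_mod_cast hsd
    have h2 : (0 : ℝ) ≤ d - s := by linarith
    positivity
  have hden : (s : ℝ) * (Real.exp ε - 1) + d = s * Real.exp ε + (d - s) := by ring
  have hp : ((d - 1).choose (s - 1) : ℝ) * Real.exp ε / qssC d s ε
      = s * Real.exp ε / (s * Real.exp ε + (d - s)) := by
    rw [qssC_eq hs hsd, hin]
    have := hpos.ne'
    field_simp
  have := hpos.ne'
  refine sum_mul_sq_error hd j _ _ _ _ (sum_qss hs hsd ε j)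
    ((sum_qss_mem hs ε j).trans hp) ?_ ?_ hm
  · rw [bss, hden]
    field_simp
    ring
  · rw [mss, bss, hden]
    field_simp
    ring

theorem mMrcSS_ge {d s N : ℕ} (hd : 2 ≤ d) (hN : 0 < N) (hsd : s ≤ d) {ε : ℝ}
    (hε : 0 ≤ ε) : mss d s ε * (1 - Real.exp ε / N) ≤ mMrcSS d s N ε := by
  have hd' : (2 : ℝ) ≤ d := by exact_mod_cast hd
  have hd1 : (0 : ℝ) < d - 1 := by linarith
  have hd0 : (0 : ℝ) < d := by linarith
  have hsd' : (s : ℝ) ≤ d := by exact_mod_cast hsd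
  have h := binomExp_hMrc_ge (μ := (s : ℝ) / d) hN hε (by positivity)
    ((div_le_one hd0).2 hsd')
  have hadd := binomExp_add N ((s : ℝ) / d) (fun _ => (s : ℝ)) (fun θ => (-1) * hMrc ε θ)
  rw [binomExp_const, binomExp_const_mul] at hadd
  simp only [neg_mul, one_mul, ← sub_eq_add_neg] at hadd
  have hm : mMrcSS d s N ε
      = d / (d - 1) * (binomExp N ((s : ℝ) / d) (hMrc ε) - (s : ℝ) / d) := by
    rw [mMrcSS, bMrcSS, hadd]
    have := hd1.ne'
    field_simp
    ring
  rw [hm, mss_eq hd hsd ε, mul_assoc]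
  exact mul_le_mul_of_nonneg_left (by linarith) (by positivity)

/-- The variance term of Subset Selection dominates its bias term by a factor `1 + 2/(e^ε-1)`. -/
theorem bias_le_variance_term {d s : ℕ} (hd : 2 ≤ d) (hs : 1 ≤ s) (hsd : s < d) {ε : ℝ}
    (hε : 0 < ε) :
    ((d : ℝ) - 1) / d * (Real.exp ε + 1)
      ≤ (Real.exp ε - 1) * ((s : ℝ) * ((d : ℝ) - s) / d / mss d s ε ^ 2) := by
  have hd' : (2 : ℝ) ≤ d := by exact_mod_cast hd
  have hd1 : (0 : ℝ) < d - 1 := by linarith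
  have hd0 : (0 : ℝ) < d := by linarith
  have hs' : (1 : ℝ) ≤ s := by exact_mod_cast hs
  have hsd' : (s : ℝ) + 1 ≤ d := by exact_mod_cast hsd
  have hds : (0 : ℝ) < d - s := by linarith
  have hE : 1 < Real.exp ε := Real.one_lt_exp_iff.2 hε
  rw [mss]
  generalize Real.exp ε = E at hE ⊢
  have hE1 : 0 < E - 1 := by linarith
  have hval : (E - 1) * ((s : ℝ) * (d - s) / d
        / ((s : ℝ) * (d - s) * (E - 1) / ((d - 1) * (s * (E - 1) + d))) ^ 2)
      = (d - 1) / d * ((d - 1) * (s * (E - 1) + d) ^ 2 / (s * (d - s) * (E - 1))) := by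
    field_simp
  rw [hval]
  refine mul_le_mul_of_nonneg_left ?_ (by positivity)
  rw [le_div_iff₀ (by positivity)]
  have h1 : s * (E - 1) * (E + 1) ≤ (s * (E - 1) + d) ^ 2 := by
    have : s * (E - 1) * (E + 1) ≤ s * (E - 1) * (s * (E - 1) + 2 * d) :=
      mul_le_mul_of_nonneg_left (by nlinarith) (by positivity)
    nlinarith
  calc (E + 1) * (s * (d - s) * (E - 1)) = (d - s) * (s * (E - 1) * (E + 1)) := by ring
    _ ≤ (d - 1) * (s * (E - 1) + d) ^ 2 :=
      mul_le_mul (by linarith) h1 (by positivity) hd1.le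

theorem candidates_bound {E lam N : ℝ} (hE : 1 ≤ E) (hlam : 0 < lam)
    (hN : N ≥ 2 * (E + 3) ^ 2 * (1 + lam) ^ 2 / ((0.24 : ℝ) ^ 2 * lam ^ 2) *
        Real.log (8 * (1 + lam) / ((0.24 : ℝ) * lam))) :
    34 * E ^ 2 * (1 + lam) ^ 2 ≤ N * lam ^ 2 := by
  have hlog : 1 ≤ Real.log (8 * (1 + lam) / ((0.24 : ℝ) * lam)) := by
    rw [Real.le_log_iff_exp_le (by positivity)]
    refine Real.exp_one_lt_three.le.trans ?_
    rw [le_div_iff₀ (by positivity)]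
    linarith
  have h1 : 2 * (E + 3) ^ 2 * (1 + lam) ^ 2 / ((0.24 : ℝ) ^ 2 * lam ^ 2) ≤ N :=
    (le_mul_of_one_le_right (by positivity) hlog).trans hN
  rw [div_le_iff₀ (by positivity)] at h1
  have h2 : E ^ 2 * (1 + lam) ^ 2 ≤ (E + 3) ^ 2 * (1 + lam) ^ 2 :=
    mul_le_mul_of_nonneg_right (by nlinarith) (by positivity)
  have h3 : 0 ≤ E ^ 2 * (1 + lam) ^ 2 := by positivity
  nlinarith

/-- A `1 - δ` loss in the scaling factor costs at most a factor `1 + 4λ + 5λ² + 2λ³` in error. -/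
theorem error_ratio_bound {E lam δ W c : ℝ} (hE : 1 ≤ E) (hlam : 0 < lam) (hδ : 0 ≤ δ)
    (hδE : 34 * (E * δ) * (1 + lam) ^ 2 ≤ lam ^ 2) (hW : 0 ≤ W)
    (hc : c * (E + 1) ≤ (E - 1) * W) :
    W / (1 - δ) ^ 2 - c ≤ (1 + 4 * lam + 5 * lam ^ 2 + 2 * lam ^ 3) * (W - c) := by
  have hEδ : 0 ≤ E * δ := by positivity
  have hδle : δ ≤ E * δ := le_mul_of_one_le_left hδ hE
  have h1 : 34 * (E * δ) ≤ lam := by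
    by_contra! h
    nlinarith [mul_lt_mul_of_pos_right h (by positivity : 0 < (1 + lam) ^ 2), pow_pos hlam 3]
  have h2 : 34 * (E * δ) ≤ 1 := by
    by_contra! h
    nlinarith [mul_lt_mul_of_pos_right h (by positivity : 0 < (1 + lam) ^ 2)]
  have hdiv : W / (1 - δ) ^ 2 ≤ W * (1 + 4 * δ) := by
    rw [div_le_iff₀ (by nlinarith), mul_assoc]
    refine le_mul_of_one_le_right hW ?_
    nlinarith [mul_nonneg hδ (by linarith : 0 ≤ 1 / 34 - δ), pow_nonneg hδ 3]
  have hWc : W * 2 ≤ (E + 1) * (W - c) := by linarith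
  have hWc0 : 0 ≤ W - c := by
    by_contra! h
    nlinarith
  have h3 : W * (4 * δ) ≤ 4 * lam * (W - c) := by
    calc W * (4 * δ) = (W * 2) * (2 * δ) := by ring
      _ ≤ (E + 1) * (W - c) * (2 * δ) := mul_le_mul_of_nonneg_right hWc (by positivity)
      _ = (2 * (E * δ + δ)) * (W - c) := by ring
      _ ≤ 4 * lam * (W - c) := mul_le_mul_of_nonneg_right (by linarith) hWc0
  have h4 : 0 ≤ (5 * lam ^ 2 + 2 * lam ^ 3) * (W - c) := by positivity
  linarith

theorem one_le_ceil_div {d : ℕ} (hd : 0 < d) (ε : ℝ) :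
    1 ≤ ⌈(d : ℝ) / (1 + Real.exp ε)⌉₊ :=
  Nat.one_le_ceil_iff.2 (by positivity)

theorem ceil_div_lt {d : ℕ} (hd : 2 ≤ d) {ε : ℝ} (hε : 0 ≤ ε) :
    ⌈(d : ℝ) / (1 + Real.exp ε)⌉₊ < d := by
  have hd' : (2 : ℝ) ≤ d := by exact_mod_cast hd
  have hE : 1 ≤ Real.exp ε := Real.one_le_exp hε
  refine Nat.lt_of_le_pred (by omega) (Nat.ceil_le.2 ?_)
  rw [Nat.pred_eq_sub_one, Nat.cast_sub (by omega), Nat.cast_one, div_le_iff₀ (by positivity)]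
  nlinarith


/-- **Theorem G.1.**  If `ε ≤ d−1` and `N ≥ 2(e^ε+3)²(1+λ)²/(0.24²λ²)·ln(8(1+λ)/(0.24λ))`,
then for every deterministic one-hot input the mean squared error of MRC simulating Subset
Selection is at most `(1+4λ+5λ²+2λ³)` times that of Subset Selection. -/
theorem mrc_ss_utility
    (d : ℕ) (hd : 2 ≤ d) (ε : ℝ) (hε1 : 1 ≤ ε) (hεd : ε ≤ (d : ℝ) - 1)
    (s : ℕ) (hs : s = ⌈(d : ℝ) / (1 + Real.exp ε)⌉₊)
    (lam : ℝ) (hlam : 0 < lam)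
    (N : ℕ) (hN0 : 0 < N)
    (hN : (N : ℝ) ≥ 2 * (Real.exp ε + 3) ^ 2 * (1 + lam) ^ 2 / ((0.24 : ℝ) ^ 2 * lam ^ 2) *
        Real.log (8 * (1 + lam) / ((0.24 : ℝ) * lam))) :
    ∀ j : Fin d,
      errMrcOne d s N ε j ≤ (1 + 4 * lam + 5 * lam ^ 2 + 2 * lam ^ 3) * errSSone d s ε j := by
  intro j
  have hε : 0 < ε := by linarith
  have hs1 : 1 ≤ s := hs ▸ one_le_ceil_div (by omega) ε
  have hsd : s < d := hs ▸ ceil_div_lt hd hε.le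
  have hd' : (2 : ℝ) ≤ d := by exact_mod_cast hd
  have hsd' : (s : ℝ) < d := by exact_mod_cast hsd
  have hd1 : (0 : ℝ) < d - 1 := by linarith
  have hds : (0 : ℝ) < d - s := by linarith
  have hE : 1 < Real.exp ε := Real.one_lt_exp_iff.2 hε
  have hE1 : 0 < Real.exp ε - 1 := by linarith
  have hmss : 0 < mss d s ε := by
    rw [mss]
    positivity
  have hNpos : (0 : ℝ) < N := by exact_mod_cast hN0
  have hNE := candidates_bound hE.le hlam hN
  have hδE : 34 * (Real.exp ε * (Real.exp ε / N)) * (1 + lam) ^ 2 ≤ lam ^ 2 := by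
    have h : 34 * (Real.exp ε * (Real.exp ε / N)) * (1 + lam) ^ 2
        = 34 * Real.exp ε ^ 2 * (1 + lam) ^ 2 / N := by ring
    rw [h, div_le_iff₀ hNpos, mul_comm (lam ^ 2)]
    exact hNE
  have hδ1 : 0 < 1 - Real.exp ε / N := by
    rw [sub_pos, div_lt_one hNpos]
    by_contra! h
    have h1 : (N : ℝ) * lam ^ 2 ≤ Real.exp ε ^ 2 * (1 + lam) ^ 2 := by
      gcongr
      · nlinarith
      · linarith
    nlinarith [show 0 < Real.exp ε ^ 2 * (1 + lam) ^ 2 by positivity]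
  have hge := mMrcSS_ge (N := N) hd hN0 hsd.le hε.le
  have hprod : 0 < mss d s ε * (1 - Real.exp ε / N) := mul_pos hmss hδ1
  rw [errMrcOne_eq hd hN0 hs1 hsd.le ε j (hprod.trans_le hge).ne',
    errSSone_eq hd hs1 hsd.le ε j hmss.ne']
  refine le_trans ?_ (error_ratio_bound hE.le hlam (δ := Real.exp ε / N) (by positivity) hδE
    (by positivity) (bias_le_variance_term hd hs1 hsd hε))
  rw [div_div _ (mss d s ε ^ 2), ← mul_pow]
  gcongr
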